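/- Let m be a finite type, n a natural number, u : Fin n → Matrix m m ℂ a sequence of invertible square complex matrices, and let P be a finite set of index pairs (a, b) in Fin n such that for every (a, b) ∈ P one has a < b and u b = (u a)⁻¹, all indices appearing as endpoints of pairs in P are pairwise distinct, and for any two distinct pairs (a₁, b₁), (a₂, b₂) ∈ P, either the pairs do not interlace or the matrices u a₁ and u a₂ commute. Then ctrl(the ordered product of u over all of Fin n) equals the ordered product over all k : Fin n of the matrices (free(u k) if k is an endpoint of some pair in P, and ctrl(u k) otherwise). -/

import Mathlib

/-- The controlled matrix: apply `U` on the second block, identity on the first. -/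
def ctrl {m : Type*} [DecidableEq m] (U : Matrix m m ℂ) : Matrix (m ⊕ m) (m ⊕ m) ℂ :=
  Matrix.fromBlocks 1 0 0 U

/-- The free (uncontrolled) matrix: apply `U` on both blocks. -/
def free {m : Type*} (U : Matrix m m ℂ) : Matrix (m ⊕ m) (m ⊕ m) ℂ :=
  Matrix.fromBlocks U 0 0 U

/-- Two index pairs `(i₁, j₁)` and `(i₂, j₂)` (each with first component smaller) interlace if
`i₁ < i₂ < j₁ < j₂` or `i₂ < i₁ < j₂ < j₁`. -/
def Interlace {n : ℕ} (p q : Fin n × Fin n) : Prop :=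
  (p.1 < q.1 ∧ q.1 < p.2 ∧ p.2 < q.2) ∨ (q.1 < p.1 ∧ p.1 < q.2 ∧ q.2 < p.2)

theorem List.prod_map_fromBlocks_diagonal {ι m R : Type*} [Fintype m] [DecidableEq m] [Semiring R]
    (A D : ι → Matrix m m R) (l : List ι) :
    (l.map fun k => Matrix.fromBlocks (A k) 0 0 (D k)).prod =
      Matrix.fromBlocks (l.map A).prod 0 0 (l.map D).prod := by
  induction l with
  | nil => simp [Matrix.fromBlocks_one]
  | cons a l ih => simp [ih, Matrix.fromBlocks_multiply]

/-- In an ordered product, two mutually inverse factors may be erased when the first one commutes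
with every factor strictly between them. -/
theorem List.prod_map_eq_prod_map_of_commute_between {α M : Type*} [LinearOrder α] [Monoid M]
    {l : List α} (hl : l.Pairwise (· < ·)) {a b : α} (ha : a ∈ l) (hb : b ∈ l) (hab : a < b)
    {f g : α → M} (hmul : f a * f b = 1) (hcomm : ∀ k, a < k → k < b → Commute (f a) (f k))
    (hga : g a = 1) (hgb : g b = 1) (hg : ∀ k, k ≠ a → k ≠ b → g k = f k) :
    (l.map f).prod = (l.map g).prod := by
  obtain ⟨s, t, rfl⟩ := List.append_of_mem ha
  rw [List.pairwise_append, List.pairwise_cons] at hl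
  obtain ⟨-, ⟨hat, ht⟩, hs⟩ := hl
  have hsa : ∀ k ∈ s, k < a := fun k hk => hs k hk a (by simp)
  have hbt : b ∈ t := by
    rcases List.mem_append.1 hb with h | h
    · exact absurd (hsa b h) hab.not_gt
    · exact (List.mem_cons.1 h).resolve_left hab.ne'
  obtain ⟨t, r, rfl⟩ := List.append_of_mem hbt
  rw [List.pairwise_append, List.pairwise_cons] at ht
  obtain ⟨-, ⟨hbr, -⟩, htr⟩ := ht
  have htb : ∀ k ∈ t, k < b := fun k hk => htr k hk b (by simp)
  have hta : ∀ k ∈ t, a < k := fun k hk => hat k (by simp [hk])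
  have es : s.map g = s.map f := List.map_congr_left fun k hk =>
    hg k (hsa k hk).ne ((hsa k hk).trans hab).ne
  have et : t.map g = t.map f := List.map_congr_left fun k hk =>
    hg k (hta k hk).ne' (htb k hk).ne
  have er : r.map g = r.map f := List.map_congr_left fun k hk =>
    hg k (hab.trans (hbr k hk)).ne' (hbr k hk).ne'
  have hc : Commute (f a) (t.map f).prod := Commute.list_prod_right _ _ fun x hx => by
    obtain ⟨k, hk, rfl⟩ := List.mem_map.1 hx
    exact hcomm k (hta k hk) (htb k hk)
  have key : f a * ((t.map f).prod * (f b * (r.map f).prod)) =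
      (t.map f).prod * (r.map f).prod := by
    rw [← mul_assoc, hc.eq, mul_assoc, ← mul_assoc (f a), hmul, one_mul]
  simp [es, et, er, hga, hgb, key]

/-- The ordered product of the endpoints of a family of disjoint inverse pairs is trivial when
interlacing pairs commute. -/
theorem List.prod_map_ite_endpoint_eq_one {n : ℕ} {M : Type*} [Monoid M] (f : Fin n → M)
    (P : Finset (Fin n × Fin n)) (hpair : ∀ p ∈ P, p.1 < p.2 ∧ f p.1 * f p.2 = 1)
    (hdisj : ∀ p ∈ P, ∀ q ∈ P, p ≠ q →
      p.1 ≠ q.1 ∧ p.1 ≠ q.2 ∧ p.2 ≠ q.1 ∧ p.2 ≠ q.2)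
    (hcross : ∀ p ∈ P, ∀ q ∈ P, p ≠ q → ¬ Interlace p q ∨ Commute (f p.1) (f q.1)) :
    ((List.finRange n).map fun k => if ∃ p ∈ P, k = p.1 ∨ k = p.2 then f k else 1).prod = 1 := by
  induction P using Finset.strongInduction with
  | H P ih =>
    rcases P.eq_empty_or_nonempty with rfl | hP
    · simp
    obtain ⟨p, hp, hmin⟩ := P.exists_min_image Prod.snd hP
    have hsub : ∀ q ∈ P.erase p, q ∈ P := fun q => Finset.mem_of_mem_erase
    refine Eq.trans ?_ (ih (P.erase p) (Finset.erase_ssubset hp) (fun q hq => hpair q (hsub q hq))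
      (fun q hq r hr => hdisj q (hsub q hq) r (hsub r hr))
      (fun q hq r hr => hcross q (hsub q hq) r (hsub r hr)))
    have hp1 : ∃ q ∈ P, p.1 = q.1 ∨ p.1 = q.2 := ⟨p, hp, .inl rfl⟩
    have hp2 : ∃ q ∈ P, p.2 = q.1 ∨ p.2 = q.2 := ⟨p, hp, .inr rfl⟩
    refine List.prod_map_eq_prod_map_of_commute_between (List.pairwise_lt_finRange n)
      (List.mem_finRange p.1) (List.mem_finRange p.2) (hpair p hp).1 ?_ ?_ ?_ ?_ ?_
    · simpa only [if_pos hp1, if_pos hp2] using (hpair p hp).2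
    · intro k hk1 hk2
      rw [if_pos hp1]
      split_ifs with hk
      · obtain ⟨q, hq, rfl | rfl⟩ := hk
        · have hpq : p ≠ q := by rintro rfl; exact lt_irrefl _ hk1
          have hlt : p.2 < q.2 := (hmin q hq).lt_of_ne (hdisj p hp q hq hpq).2.2.2
          exact (hcross p hp q hq hpq).resolve_left (not_not.2 (.inl ⟨hk1, hk2, hlt⟩))
        · exact absurd hk2 (hmin q hq).not_gt
      · exact Commute.one_right _
    · refine if_neg ?_
      rintro ⟨q, hq, h⟩
      have := hdisj p hp q (hsub q hq) (Finset.ne_of_mem_erase hq).symm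
      tauto
    · refine if_neg ?_
      rintro ⟨q, hq, h⟩
      have := hdisj p hp q (hsub q hq) (Finset.ne_of_mem_erase hq).symm
      tauto
    · intro k hk1 hk2
      refine if_congr ⟨?_, ?_⟩ rfl rfl
      · rintro ⟨q, hq, h⟩
        exact ⟨q, hsub q hq, h⟩
      · rintro ⟨q, hq, h⟩
        refine ⟨q, Finset.mem_erase.2 ⟨?_, hq⟩, h⟩
        rintro rfl
        tauto

/-- Given a set of conjugation pairs with pairwise distinct endpoints such that any two distinct
pairs either do not interlace or have commuting operations, the control of all the paired
operations may be skipped when controlling the whole product. -/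
theorem ctrl_prod_skip_conj_pairs {m : Type*} [Fintype m] [DecidableEq m] (n : ℕ)
    (u : Fin n → Matrix m m ℂ) (hu : ∀ k, IsUnit (u k))
    (P : Finset (Fin n × Fin n))
    (hpair : ∀ p ∈ P, p.1 < p.2 ∧ u p.2 = (u p.1)⁻¹)
    (hdisj : ∀ p ∈ P, ∀ q ∈ P, p ≠ q →
      p.1 ≠ q.1 ∧ p.1 ≠ q.2 ∧ p.2 ≠ q.1 ∧ p.2 ≠ q.2)
    (hcross : ∀ p ∈ P, ∀ q ∈ P, p ≠ q → ¬ Interlace p q ∨ Commute (u p.1) (u q.1)) :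
    ctrl ((List.finRange n).map u).prod =
      ((List.finRange n).map fun k =>
        if ∃ p ∈ P, k = p.1 ∨ k = p.2 then free (u k) else ctrl (u k)).prod := by
  have hblocks : (fun k => if ∃ p ∈ P, k = p.1 ∨ k = p.2 then free (u k) else ctrl (u k)) =
      fun k => Matrix.fromBlocks (if ∃ p ∈ P, k = p.1 ∨ k = p.2 then u k else 1) 0 0 (u k) := by
    funext k
    split_ifs <;> rfl
  rw [hblocks, List.prod_map_fromBlocks_diagonal, List.prod_map_ite_endpoint_eq_one u P
    (fun p hp => ⟨(hpair p hp).1, ?_⟩) hdisj hcross, ctrl]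
  rw [(hpair p hp).2]
  exact Matrix.mul_nonsing_inv _ ((Matrix.isUnit_iff_isUnit_det _).1 (hu p.1))
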